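/- Let 0 < α, β ≤ 1, let a ≠ 0, b ≠ 0 and γ be real constants, and let Φ : (0,∞) → ℝ be twice continuously differentiable with Φ(ζ) ≠ 0 for all ζ > 0. Define Ψ(ζ) = (2b/a)·D^αΦ(ζ)/Φ(ζ). Then Ψ satisfies the fractional Riccati equation b·D^αΨ(ζ) + (a/2)·Ψ(ζ)² − (β/2)·(ζ^α/α)·Ψ(ζ) = γ for all ζ > 0 if and only if Φ satisfies the linear equation D^{2α}Φ(ζ) − (β/(2b))·(ζ^α/α)·D^αΦ(ζ) − (aγ/(2b²))·Φ(ζ) = 0 for all ζ > 0. -/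

import Mathlib

open Filter Set MeasureTheory

/-- `f` is α-differentiable at `t` with conformable fractional derivative `L`:
`D^α f(t) = lim_{ε→0} (f(t + ε t^{1-α}) - f t)/ε = L`. -/
def HasConfDerivAt (α : ℝ) (f : ℝ → ℝ) (L t : ℝ) : Prop :=
  Filter.Tendsto (fun ε : ℝ => (f (t + ε * t ^ (1 - α)) - f t) / ε)
    (nhdsWithin 0 {(0 : ℝ)}ᶜ) (nhds L)

/-- The conformable fractional derivative operator `D^α` (junk value if the limit
does not exist). -/
noncomputable def confDeriv (α : ℝ) (f : ℝ → ℝ) (t : ℝ) : ℝ :=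
  limUnder (nhdsWithin 0 {(0 : ℝ)}ᶜ)
    (fun ε : ℝ => (f (t + ε * t ^ (1 - α)) - f t) / ε)

theorem HasDerivAt.hasConfDerivAt {f : ℝ → ℝ} {f' t : ℝ} (α : ℝ)
    (hf : HasDerivAt f f' t) : HasConfDerivAt α f (t ^ (1 - α) * f') t := by
  have h1 : HasDerivAt (fun ε : ℝ => t + ε * t ^ (1 - α)) (t ^ (1 - α)) 0 := by
    simpa using ((hasDerivAt_id (0 : ℝ)).mul_const (t ^ (1 - α))).const_add t
  have hf0 : HasDerivAt f f' (t + 0 * t ^ (1 - α)) := by simpa using hf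
  have h2 := hasDerivAt_iff_tendsto_slope_zero.1 (hf0.comp (0 : ℝ) h1)
  rw [mul_comm f'] at h2
  refine h2.congr fun ε => ?_
  simp [div_eq_inv_mul]

theorem HasDerivAt.confDeriv_eq {f : ℝ → ℝ} {f' t : ℝ} (α : ℝ)
    (hf : HasDerivAt f f' t) : confDeriv α f t = t ^ (1 - α) * f' :=
  (hf.hasConfDerivAt α).limUnder_eq

theorem fractional_riccati_linearization (α β a b γ : ℝ) (hα : 0 < α ∧ α ≤ 1)
    (hβ : 0 < β ∧ β ≤ 1) (ha : a ≠ 0) (hb : b ≠ 0)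
    (Φ : ℝ → ℝ) (hΦ : ContDiffOn ℝ 2 Φ (Set.Ioi 0))
    (hΦne : ∀ ζ > (0 : ℝ), Φ ζ ≠ 0)
    (Ψ : ℝ → ℝ)
    (hΨ : ∀ ζ : ℝ, Ψ ζ = (2 * b / a) * confDeriv α Φ ζ / Φ ζ) :
    (∀ ζ > (0 : ℝ),
      b * confDeriv α Ψ ζ + (a / 2) * (Ψ ζ) ^ 2
        - (β / 2) * (ζ ^ α / α) * Ψ ζ = γ) ↔
    (∀ ζ > (0 : ℝ),
      confDeriv α (confDeriv α Φ) ζ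
        - (β / (2 * b)) * (ζ ^ α / α) * confDeriv α Φ ζ
        - (a * γ / (2 * b ^ 2)) * Φ ζ = 0) := by
  have hderivΦ : ∀ ζ > (0 : ℝ), HasDerivAt Φ (deriv Φ ζ) ζ := fun ζ hζ =>
    ((hΦ.differentiableOn (by norm_num)).differentiableAt (Ioi_mem_nhds hζ)).hasDerivAt
  have hderiv : DifferentiableOn ℝ (deriv Φ) (Set.Ioi 0) :=
    (((contDiffOn_succ_iff_deriv_of_isOpen (n := 1) isOpen_Ioi).1
      (by simpa [one_add_one_eq_two] using hΦ)).2.2).differentiableOn (by norm_num)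
  have hconf : ∀ ζ > (0 : ℝ), DifferentiableAt ℝ (confDeriv α Φ) ζ := fun ζ hζ => by
    have h : DifferentiableAt ℝ (fun x : ℝ => x ^ (1 - α) * deriv Φ x) ζ :=
      (Real.differentiableAt_rpow_const_of_ne _ hζ.ne').mul
        (hderiv.differentiableAt (Ioi_mem_nhds hζ))
    refine h.congr_of_eventuallyEq ?_
    filter_upwards [Ioi_mem_nhds hζ] with x hx
    exact (hderivΦ x hx).confDeriv_eq α
  refine forall₂_congr fun ζ hζ => ?_
  have hne := hΦne ζ hζ
  have h1 := (hderivΦ ζ hζ).confDeriv_eq α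
  have h2 := (hconf ζ hζ).hasDerivAt.confDeriv_eq α
  have h3 := ((((hconf ζ hζ).hasDerivAt.const_mul (2 * b / a)).div
    (hderivΦ ζ hζ) hne).congr_of_eventuallyEq
    (Eventually.of_forall hΨ)).confDeriv_eq α
  have hΨ' : confDeriv α Ψ ζ = 2 * b / a *
      (confDeriv α (confDeriv α Φ) ζ / Φ ζ - confDeriv α Φ ζ ^ 2 / Φ ζ ^ 2) := by
    rw [h3, h2, pow_two, h1]
    field_simp
  have key : b * confDeriv α Ψ ζ + (a / 2) * (Ψ ζ) ^ 2 - (β / 2) * (ζ ^ α / α) * Ψ ζ - γ =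
      2 * b ^ 2 / (a * Φ ζ) * (confDeriv α (confDeriv α Φ) ζ
        - (β / (2 * b)) * (ζ ^ α / α) * confDeriv α Φ ζ - (a * γ / (2 * b ^ 2)) * Φ ζ) := by
    have hα0 := hα.1.ne'
    rw [hΨ', hΨ]
    field_simp
    ring
  have hc : 2 * b ^ 2 / (a * Φ ζ) ≠ 0 := by positivity
  rw [← sub_eq_zero, key, mul_eq_zero, or_iff_right hc]
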